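/- Let f = a_0·z_1^4 + 4a_1·z_1³z_2 + 6a_2·z_1²z_2² + 4a_3·z_1z_2³ + a_4·z_2^4 be a nondegenerate binary quartic. Define I_2(f) := a_0a_4 − 4a_1a_3 + 3a_2², Cat(f) := det[[a_0,a_1,a_2],[a_1,a_2,a_3],[a_2,a_3,a_4]], and Δ(f) := I_2(f)³ − 27·Cat(f)². Then, with 𝐟 the associated form of f, the following identity of binary quartics in z_1, z_2 holds: Δ(f)·𝐟(−z_2, z_1) = (1/3456)·I_2(f)·Hess(f)(z_1,z_2) − (1/16)·Cat(f)·f(z_1,z_2). -/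

import Mathlib

open MvPolynomial

noncomputable section

/-- The gradient ideal `(f_{z_1},…,f_{z_n})` of a form `f`. -/
def gradIdeal (n : ℕ) (f : MvPolynomial (Fin n) ℂ) : Ideal (MvPolynomial (Fin n) ℂ) :=
  Ideal.span (Set.range fun i => pderiv i f)

/-- The Hessian `det (∂²f/∂z_i∂z_j)` of a form `f`. -/
def hess (n : ℕ) (f : MvPolynomial (Fin n) ℂ) : MvPolynomial (Fin n) ℂ :=
  Matrix.det (Matrix.of fun i j : Fin n => pderiv i (pderiv j f))

/-- `μ` is the system of coefficients defining the associated form of `f`: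
for each multi-index `m` with `|m| = n(d-2)`, the scalar `μ m` satisfies
`z^m - μ m · Hess f ∈ (f_{z_1},…,f_{z_n})`. -/
def IsAssocCoeffs (n d : ℕ) (f : MvPolynomial (Fin n) ℂ) (μ : (Fin n → ℕ) → ℂ) : Prop :=
  ∀ m : Fin n → ℕ, (∑ i, m i) = n * (d - 2) →
    (∏ i, X i ^ m i) - C (μ m) * hess n f ∈ gradIdeal n f

/-- The associated form `Σ_{|m| = n(d-2)} (n(d-2))!/(m_1!⋯m_n!) · μ m · e^m`
built from the coefficients `μ`. -/
def assocForm (n d : ℕ) (μ : (Fin n → ℕ) → ℂ) : MvPolynomial (Fin n) ℂ :=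
  ∑ m ∈ Finset.Nat.antidiagonalTuple n (n * (d - 2)),
    C ((Nat.multinomial Finset.univ m : ℂ) * μ m) * ∏ i, X i ^ m i

end

namespace BinaryQuartic

lemma C_ofNat (n : ℕ) [n.AtLeastTwo] :
    (C ofNat(n) : MvPolynomial (Fin 2) ℂ) = ofNat(n) :=
  map_ofNat C n

/-- The exponent of the monomial `z_1^i z_2^j`. -/
noncomputable def expo (i j : ℕ) : Fin 2 →₀ ℕ := Finsupp.single 0 i + Finsupp.single 1 j

lemma term_eq_monomial (c : ℂ) (k l : ℕ) :
    (C c * X 0 ^ k * X 1 ^ l : MvPolynomial (Fin 2) ℂ) = monomial (expo k l) c := by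
  rw [X_pow_eq_monomial, X_pow_eq_monomial, C_mul_monomial, monomial_mul]
  simp [expo]

lemma coeff_mul_term (g : MvPolynomial (Fin 2) ℂ) (c : ℂ) (i j k l : ℕ) :
    coeff (expo i j) (g * (C c * X 0 ^ k * X 1 ^ l))
      = if k ≤ i ∧ l ≤ j then coeff (expo (i - k) (j - l)) g * c else 0 := by
  have hle : expo k l ≤ expo i j ↔ k ≤ i ∧ l ≤ j := by
    simp [Finsupp.le_def, Fin.forall_fin_two, expo]
  have hsub : expo i j - expo k l = expo (i - k) (j - l) := by
    ext t
    fin_cases t <;> simp [expo]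
  rw [term_eq_monomial, coeff_mul_monomial']
  simp only [hle, hsub]

lemma coeff_term (c : ℂ) (i j k l : ℕ) :
    coeff (expo i j) (C c * X 0 ^ k * X 1 ^ l : MvPolynomial (Fin 2) ℂ)
      = if k = i ∧ l = j then c else 0 := by
  have heq : expo k l = expo i j ↔ k = i ∧ l = j := by
    simp [Finsupp.ext_iff, Fin.forall_fin_two, expo]
  rw [term_eq_monomial, coeff_monomial]
  simp only [heq]

/-- The binary form of degree four with binomially weighted coefficients `a0, …, a4`. -/
noncomputable def quartic (a0 a1 a2 a3 a4 : ℂ) : MvPolynomial (Fin 2) ℂ :=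
  C a0 * X 0 ^ 4 + C (4 * a1) * X 0 ^ 3 * X 1 + C (6 * a2) * X 0 ^ 2 * X 1 ^ 2
    + C (4 * a3) * X 0 * X 1 ^ 3 + C a4 * X 1 ^ 4

lemma pderiv_zero_quartic (a0 a1 a2 a3 a4 : ℂ) :
    pderiv 0 (quartic a0 a1 a2 a3 a4)
      = C (4 * a0) * X 0 ^ 3 * X 1 ^ 0 + C (12 * a1) * X 0 ^ 2 * X 1 ^ 1
        + C (12 * a2) * X 0 ^ 1 * X 1 ^ 2 + C (4 * a3) * X 0 ^ 0 * X 1 ^ 3 := by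
  simp [quartic, pderiv_X]
  simp only [C_ofNat]
  ring

lemma pderiv_one_quartic (a0 a1 a2 a3 a4 : ℂ) :
    pderiv 1 (quartic a0 a1 a2 a3 a4)
      = C (4 * a1) * X 0 ^ 3 * X 1 ^ 0 + C (12 * a2) * X 0 ^ 2 * X 1 ^ 1
        + C (12 * a3) * X 0 ^ 1 * X 1 ^ 2 + C (4 * a4) * X 0 ^ 0 * X 1 ^ 3 := by
  simp [quartic, pderiv_X]
  simp only [C_ofNat]
  ring

lemma hess_quartic (a0 a1 a2 a3 a4 : ℂ) :
    hess 2 (quartic a0 a1 a2 a3 a4)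
      = C (144 * (a0 * a2 - a1 ^ 2)) * X 0 ^ 4 * X 1 ^ 0
        + C (288 * (a0 * a3 - a1 * a2)) * X 0 ^ 3 * X 1 ^ 1
        + C (144 * (a0 * a4 + 2 * a1 * a3 - 3 * a2 ^ 2)) * X 0 ^ 2 * X 1 ^ 2
        + C (288 * (a1 * a4 - a2 * a3)) * X 0 ^ 1 * X 1 ^ 3
        + C (144 * (a2 * a4 - a3 ^ 2)) * X 0 ^ 0 * X 1 ^ 4 := by
  rw [hess, Matrix.det_fin_two]
  simp only [Matrix.of_apply, pderiv_zero_quartic, pderiv_one_quartic]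
  simp [pderiv_X]
  simp only [C_ofNat]
  ring

/-- The functional on quartics with value `l i` on `z_1^i z_2^(4-i)`, extended by zero to
the other monomials. -/
noncomputable def quarticFunctional (l : Fin 5 → ℂ) (p : MvPolynomial (Fin 2) ℂ) : ℂ :=
  l 0 * coeff (expo 0 4) p + l 1 * coeff (expo 1 3) p + l 2 * coeff (expo 2 2) p
    + l 3 * coeff (expo 3 1) p + l 4 * coeff (expo 4 0) p

/-- The invariant of degree two of a quartic. -/
def invI (a0 a1 a2 a3 a4 : ℂ) : ℂ := a0 * a4 - 4 * a1 * a3 + 3 * a2 ^ 2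

/-- The catalecticant of a quartic, expanded. -/
def invCat (a0 a1 a2 a3 a4 : ℂ) : ℂ :=
  a0 * a2 * a4 - a0 * a3 ^ 2 - a1 ^ 2 * a4 + 2 * a1 * a2 * a3 - a2 ^ 3

/-- The values on monomials of the functional dual to the Hessian modulo the gradient ideal,
scaled by the discriminant. -/
noncomputable def dualValues (a0 a1 a2 a3 a4 : ℂ) : Fin 5 → ℂ :=
  let I := invI a0 a1 a2 a3 a4 / 3456
  let J := invCat a0 a1 a2 a3 a4 / 16
  ![144 * I * (a0 * a2 - a1 ^ 2) - J * a0,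
    -(72 * I * (a0 * a3 - a1 * a2) - J * a1),
    24 * I * (a0 * a4 + 2 * a1 * a3 - 3 * a2 ^ 2) - J * a2,
    -(72 * I * (a1 * a4 - a2 * a3) - J * a3),
    144 * I * (a2 * a4 - a3 ^ 2) - J * a4]

lemma quarticFunctional_eq_zero_of_mem_gradIdeal (a0 a1 a2 a3 a4 : ℂ)
    {p : MvPolynomial (Fin 2) ℂ} (hp : p ∈ gradIdeal 2 (quartic a0 a1 a2 a3 a4)) :
    quarticFunctional (dualValues a0 a1 a2 a3 a4) p = 0 := by
  obtain ⟨g, rfl⟩ := Ideal.mem_span_range_iff_exists_fun.mp hp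
  simp only [Fin.sum_univ_two, pderiv_zero_quartic, pderiv_one_quartic, quarticFunctional,
    mul_add, coeff_add, coeff_mul_term]
  simp [dualValues, invI, invCat]
  ring

lemma quarticFunctional_hess (a0 a1 a2 a3 a4 : ℂ) :
    quarticFunctional (dualValues a0 a1 a2 a3 a4) (hess 2 (quartic a0 a1 a2 a3 a4))
      = invI a0 a1 a2 a3 a4 ^ 3 - 27 * invCat a0 a1 a2 a3 a4 ^ 2 := by
  simp only [hess_quartic, quarticFunctional, coeff_add, coeff_term]
  simp [dualValues, invI, invCat]
  ring

lemma discr_mul_assocCoeff (a0 a1 a2 a3 a4 : ℂ) {μ : (Fin 2 → ℕ) → ℂ}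
    (hμ : IsAssocCoeffs 2 4 (quartic a0 a1 a2 a3 a4) μ) (i : Fin 5) :
    (invI a0 a1 a2 a3 a4 ^ 3 - 27 * invCat a0 a1 a2 a3 a4 ^ 2) * μ ![i, 4 - i]
      = dualValues a0 a1 a2 a3 a4 i := by
  have hmem := hμ ![i, 4 - i] (by simp [Fin.sum_univ_two]; omega)
  have hzero := quarticFunctional_eq_zero_of_mem_gradIdeal a0 a1 a2 a3 a4 hmem
  have hmon : quarticFunctional (dualValues a0 a1 a2 a3 a4)
      (∏ t, X t ^ (![(i : ℕ), 4 - i] : Fin 2 → ℕ) t) = dualValues a0 a1 a2 a3 a4 i := by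
    have hone : (∏ t, X t ^ (![(i : ℕ), 4 - i] : Fin 2 → ℕ) t : MvPolynomial (Fin 2) ℂ)
        = C 1 * X 0 ^ (i : ℕ) * X 1 ^ (4 - i : ℕ) := by
      simp [Fin.prod_univ_two]
    rw [hone]
    simp only [quarticFunctional, coeff_term]
    fin_cases i <;> simp
  rw [← quarticFunctional_hess, ← hmon]
  simp only [quarticFunctional, coeff_sub, coeff_C_mul] at hzero ⊢
  linear_combination -hzero

end BinaryQuartic

open BinaryQuartic in
/-- For a nondegenerate binary quartic
`f = a₀z_1⁴ + 4a₁z_1³z_2 + 6a₂z_1²z_2² + 4a₃z_1z_2³ + a₄z_2⁴`, with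
`I₂ = a₀a₄ - 4a₁a₃ + 3a₂²`, `Cat` the 3×3 catalecticant determinant and
`Δ = I₂³ - 27 Cat²`, the associated form `𝐟` of `f` satisfies
`Δ·𝐟(-z_2, z_1) = (1/3456)·I₂·Hess f - (1/16)·Cat·f`. -/
theorem binary_quartic_contravariant_identity
    (a0 a1 a2 a3 a4 : ℂ) :
    letI f : MvPolynomial (Fin 2) ℂ :=
      C a0 * X 0 ^ 4 + C (4 * a1) * X 0 ^ 3 * X 1 + C (6 * a2) * X 0 ^ 2 * X 1 ^ 2
        + C (4 * a3) * X 0 * X 1 ^ 3 + C a4 * X 1 ^ 4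
    letI I2 : ℂ := a0 * a4 - 4 * a1 * a3 + 3 * a2 ^ 2
    letI cat : ℂ := Matrix.det !![a0, a1, a2; a1, a2, a3; a2, a3, a4]
    letI Δ : ℂ := I2 ^ 3 - 27 * cat ^ 2
    (∀ p : Fin 2 → ℂ, (∀ i, eval p (pderiv i f) = 0) → p = 0) →
      ∀ μ : (Fin 2 → ℕ) → ℂ, IsAssocCoeffs 2 4 f μ →
        C Δ * aeval ![-X 1, X 0] (assocForm 2 4 μ)
          = C (I2 / 3456) * hess 2 f - C (cat / 16) * f := by
  intro _ μ hμ
  change IsAssocCoeffs 2 4 (quartic a0 a1 a2 a3 a4) μ at hμ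
  change _ = C _ * hess 2 (quartic a0 a1 a2 a3 a4) - C _ * quartic a0 a1 a2 a3 a4
  have hcat : Matrix.det !![a0, a1, a2; a1, a2, a3; a2, a3, a4] = invCat a0 a1 a2 a3 a4 := by
    simp [Matrix.det_fin_three, invCat]
    ring
  have hI : a0 * a4 - 4 * a1 * a3 + 3 * a2 ^ 2 = invI a0 a1 a2 a3 a4 := rfl
  have hval (i : Fin 5) := congrArg (C (σ := Fin 2)) (discr_mul_assocCoeff a0 a1 a2 a3 a4 hμ i)
  have h0 := hval 0
  have h1 := hval 1
  have h2 := hval 2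
  have h3 := hval 3
  have h4 := hval 4
  rw [hcat, hI, hess_quartic]
  have hanti : Finset.Nat.antidiagonalTuple 2 (2 * (4 - 2))
      = {![0, 4], ![1, 3], ![2, 2], ![3, 1], ![4, 0]} := by decide
  rw [assocForm, hanti]
  simp [Nat.multinomial, Fin.sum_univ_two, Fin.prod_univ_two, Nat.factorial, quartic, map_ofNat]
  simp [dualValues, C_ofNat] at h0 h1 h2 h3 h4
  linear_combination X 0 ^ 4 * h0 - 4 * X 0 ^ 3 * X 1 * h1 + 6 * X 0 ^ 2 * X 1 ^ 2 * h2
    - 4 * X 0 * X 1 ^ 3 * h3 + X 1 ^ 4 * h4
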